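/- arXiv:1808.03602 — 4 statements merged into one kernel-verified Lean document; each statement's English description precedes it below -/
import Mathlib

section
/- For all virtual activity states x, y ∈ 𝒳*, the transition rate of the single-channel CSMA dynamics on the virtual graph G* satisfies q*(x,y) = q_C(𝒱(x), 𝒱(y)); i.e., the bijection 𝒱 intertwines the single-channel transition rates on G* with the multi-channel transition rates on G_1,…,G_C. -/
open scoped Classical

noncomputable section

namespace CSMA

/-- An activity state of a multi-channel CSMA network with `N` nodes and `C` channels:
node `i` is inactive if `x i = 0` and active on channel `c` if `x i = c` (`1 ≤ c ≤ C`). -/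
abbrev CState (N C : ℕ) := Fin N → Fin (C + 1)

/-- Feasibility of an activity state: for every channel `c` and every edge of the conflict
graph `E c`, the two endpoints are not both active on channel `c`. -/
def Feasible {N C : ℕ} (E : Fin C → SimpleGraph (Fin N)) (x : CState N C) : Prop :=
  ∀ c : Fin C, ∀ i j : Fin N, (E c).Adj i j → ¬(x i = c.succ ∧ x j = c.succ)

/-- The multi-channel transition rates `q_C`: `q_C(x,y) = ν_{i,c}` if `y = x + c·e_i ∈ 𝒳_C`,
`q_C(x,y) = μ_{i,c}` if `y = x − c·e_i ∈ 𝒳_C`, and `q_C(x,y) = 0` otherwise.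
(At most one summand below is nonzero.) -/
def qC {N C : ℕ} (E : Fin C → SimpleGraph (Fin N)) (ν μ : Fin N → Fin C → ℝ)
    (x y : CState N C) : ℝ :=
  (∑ i : Fin N, ∑ c : Fin C,
    if Feasible E x ∧ Feasible E y ∧ x i = 0 ∧ y = Function.update x i c.succ
    then ν i c else 0) +
  (∑ i : Fin N, ∑ c : Fin C,
    if Feasible E x ∧ Feasible E y ∧ x i = c.succ ∧ y = Function.update x i 0
    then μ i c else 0)

/-- A virtual activity state: a `0`-`1` vector indexed by the virtual nodes `(i,c)`. -/
abbrev VState (N C : ℕ) := Fin N × Fin C → Bool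

/-- Adjacency in the virtual conflict graph `G*`: `(i,c)` and `(i',c')` are adjacent iff
(`i = i'` and `c ≠ c'`) or (`c = c'` and `(i,i')` is an edge of `E c`). -/
def VirtualAdj {N C : ℕ} (E : Fin C → SimpleGraph (Fin N)) :
    Fin N × Fin C → Fin N × Fin C → Prop := fun p q =>
  (p.1 = q.1 ∧ p.2 ≠ q.2) ∨ (p.2 = q.2 ∧ (E p.2).Adj p.1 q.1)

/-- `x ∈ 𝒳*`: the virtual state `x` is the indicator vector of an independent set of `G*`. -/
def VFeasible {N C : ℕ} (E : Fin C → SimpleGraph (Fin N)) (x : VState N C) : Prop :=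
  ∀ p q : Fin N × Fin C, VirtualAdj E p q → ¬(x p = true ∧ x q = true)

/-- The single-channel CSMA transition rates `q*` on the virtual network `G*`:
`q*(x,y) = ν_{i,c}` if `y = x + e_{(i,c)} ∈ 𝒳*`, `q*(x,y) = μ_{i,c}` if
`y = x − e_{(i,c)} ∈ 𝒳*`, and `q*(x,y) = 0` otherwise. -/
def qStar {N C : ℕ} (E : Fin C → SimpleGraph (Fin N)) (ν μ : Fin N → Fin C → ℝ)
    (x y : VState N C) : ℝ :=
  (∑ i : Fin N, ∑ c : Fin C,
    if VFeasible E x ∧ VFeasible E y ∧ x (i, c) = false ∧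
        y = Function.update x (i, c) true
    then ν i c else 0) +
  (∑ i : Fin N, ∑ c : Fin C,
    if VFeasible E x ∧ VFeasible E y ∧ x (i, c) = true ∧
        y = Function.update x (i, c) false
    then μ i c else 0)

/-- The activity state `a` encodes the virtual state `u`: node `i` is active on channel `c` in `a`
exactly when the virtual node `(i, c)` is active in `u`. -/
def Encodes {N C : ℕ} (a : CState N C) (u : VState N C) : Prop :=
  ∀ i c, a i = Fin.succ c ↔ u (i, c) = true

theorem eq_of_forall_eq_succ_iff {n : ℕ} {p q : Fin (n + 1)}
    (h : ∀ d : Fin n, p = d.succ ↔ q = d.succ) : p = q := by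
  induction p using Fin.cases with
  | zero =>
    induction q using Fin.cases with
    | zero => rfl
    | succ d => exact (h d).2 rfl
  | succ d => exact ((h d).1 rfl).symm

namespace Encodes

variable {N C : ℕ} {a b : CState N C} {u w : VState N C}

theorem state_unique (ha : Encodes a u) (hb : Encodes b u) : a = b :=
  funext fun i => eq_of_forall_eq_succ_iff fun d => (ha i d).trans (hb i d).symm

theorem virtual_unique (hu : Encodes a u) (hw : Encodes a w) : u = w :=
  funext fun p => Bool.eq_iff_iff.2 ((hu p.1 p.2).symm.trans (hw p.1 p.2))

theorem deactivate (ha : Encodes a u) {i : Fin N} {c : Fin C} (hi : a i = c.succ) :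
    Encodes (Function.update a i 0) (Function.update u (i, c) false) := by
  intro j d
  by_cases hj : j = i
  · subst hj
    by_cases hd : d = c
    · subst hd
      simp [(Fin.succ_ne_zero d).symm]
    · have hne : c.succ ≠ d.succ := fun h => hd (Fin.succ_injective _ h).symm
      have hu : u (j, d) ≠ true := fun h => hne (hi.symm.trans ((ha j d).2 h))
      simp [hd, hu, (Fin.succ_ne_zero d).symm]
  · simpa [hj] using ha j d

theorem deactivation_iff (ha : Encodes a u) (hb : Encodes b w) (i : Fin N) (c : Fin C) :
    (u (i, c) = true ∧ w = Function.update u (i, c) false) ↔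
      (a i = c.succ ∧ b = Function.update a i 0) := by
  rw [← ha i c]
  refine and_congr_right fun hi => ⟨?_, ?_⟩
  · rintro rfl
    exact hb.state_unique (ha.deactivate hi)
  · rintro rfl
    exact hb.virtual_unique (ha.deactivate hi)

end Encodes

theorem eq_update_swap {α β : Type*} [DecidableEq α] {f g : α → β} {i : α} {s t : β} :
    (f i = s ∧ g = Function.update f i t) ↔ (g i = t ∧ f = Function.update g i s) := by
  constructor <;> rintro ⟨rfl, rfl⟩ <;> simp

theorem Encodes.activation_iff {N C : ℕ} {a b : CState N C} {u w : VState N C}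
    (ha : Encodes a u) (hb : Encodes b w) (i : Fin N) (c : Fin C) :
    (u (i, c) = false ∧ w = Function.update u (i, c) true) ↔
      (a i = 0 ∧ b = Function.update a i c.succ) := by
  have h := hb.deactivation_iff ha i c
  rwa [eq_update_swap, eq_update_swap (f := b)] at h

/-- For all virtual activity states `x, y ∈ 𝒳*`, the transition rate of the
single-channel CSMA dynamics on the virtual graph `G*` satisfies
`q*(x,y) = q_C(𝒱(x), 𝒱(y))`: the bijection `𝒱` intertwines the single-channel rates on `G*`
with the multi-channel rates on `G_1, …, G_C`. -/
theorem virtual_representation_rates (N C : ℕ) (hC : 1 ≤ C)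
    (E : Fin C → SimpleGraph (Fin N)) (ν μ : Fin N → Fin C → ℝ)
    (hν : ∀ i c, 0 < ν i c) (hμ : ∀ i c, 0 < μ i c)
    (V : {x : VState N C // VFeasible E x} ≃ {y : CState N C // Feasible E y})
    (hV : ∀ (x : {x : VState N C // VFeasible E x}) (i : Fin N) (c : Fin C),
      (V x).1 i = c.succ ↔ x.1 (i, c) = true) :
    ∀ x y : {x : VState N C // VFeasible E x},
      qStar E ν μ x.1 y.1 = qC E ν μ (V x).1 (V y).1 := by
  intro x y
  have hx : Encodes (V x).1 x.1 := hV x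
  have hy : Encodes (V y).1 y.1 := hV y
  simp only [qStar, qC, x.2, y.2, (V x).2, (V y).2, true_and,
    hx.activation_iff hy, hx.deactivation_iff hy]

end CSMA
end
end

section
/- The product-form distribution π_C(x) = Z^{-1} ∏_{i=1}^N ∏_{c=1}^C (ν_{i,c}/μ_{i,c})^{1{x_i = c}} on 𝒳_C, with Z the normalizing constant making π_C a probability distribution, satisfies the detailed balance equations π_C(x) q_C(x,y) = π_C(y) q_C(y,x) for all x, y ∈ 𝒳_C; hence π_C is a reversible (and thus stationary) distribution for the multi-channel CSMA dynamics. -/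
open scoped Classical

noncomputable section

namespace CSMA

/-- The finite set `𝒳_C` of feasible activity states. -/
def FeasibleSet {N C : ℕ} (E : Fin C → SimpleGraph (Fin N)) : Finset (CState N C) :=
  Finset.univ.filter fun x => Feasible E x

/-- The unnormalized product-form weight `∏_{i=1}^N ∏_{c=1}^C (ν_{i,c}/μ_{i,c})^{1{x_i = c}}`. -/
def prodWeight {N C : ℕ} (ν μ : Fin N → Fin C → ℝ) (x : CState N C) : ℝ :=
  ∏ i : Fin N, ∏ c : Fin C, (ν i c / μ i c) ^ (if x i = c.succ then 1 else 0)

/-- The normalizing constant `Z` for the product-form distribution. -/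
def Zprod {N C : ℕ} (E : Fin C → SimpleGraph (Fin N)) (ν μ : Fin N → Fin C → ℝ) : ℝ :=
  ∑ x ∈ FeasibleSet E, prodWeight ν μ x

/-- The product-form distribution `π_C(x) = Z⁻¹ ∏_i ∏_c (ν_{i,c}/μ_{i,c})^{1{x_i = c}}`. -/
def piProd {N C : ℕ} (E : Fin C → SimpleGraph (Fin N)) (ν μ : Fin N → Fin C → ℝ)
    (x : CState N C) : ℝ :=
  prodWeight ν μ x / Zprod E ν μ

/-- Activating an idle node `i` on channel `c` multiplies the weight by `ν i c / μ i c`. -/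
theorem prodWeight_update {N C : ℕ} (ν μ : Fin N → Fin C → ℝ) {x : CState N C} {i : Fin N}
    (hx : x i = 0) (c : Fin C) :
    prodWeight ν μ (Function.update x i c.succ) = prodWeight ν μ x * (ν i c / μ i c) := by
  unfold prodWeight
  rw [← Finset.mul_prod_erase Finset.univ _ (Finset.mem_univ i),
    ← Finset.mul_prod_erase Finset.univ
      (fun j => ∏ d : Fin C, (ν j d / μ j d) ^ (if x j = d.succ then 1 else 0))
      (Finset.mem_univ i)]
  have hrest : ∀ j ∈ Finset.univ.erase i,
      (∏ d : Fin C, (ν j d / μ j d) ^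
        (if Function.update x i c.succ j = d.succ then 1 else 0)) =
      ∏ d : Fin C, (ν j d / μ j d) ^ (if x j = d.succ then 1 else 0) := fun j hj => by
    simp only [Function.update_of_ne (Finset.ne_of_mem_erase hj)]
  have hidle : ∀ d : Fin C, ¬ (0 : Fin (C + 1)) = d.succ := fun d => (Fin.succ_ne_zero d).symm
  rw [Finset.prod_congr rfl hrest]
  simp [hx, hidle, pow_ite, mul_comm]

/-- The activation of node `i` on channel `c` leads from `x` to `y` exactly when its
deactivation leads from `y` to `x`. -/
theorem activation_iff_deactivation {N C : ℕ} (x y : CState N C) (i : Fin N) (c : Fin C) :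
    (x i = 0 ∧ y = Function.update x i c.succ) ↔
      (y i = c.succ ∧ x = Function.update y i 0) := by
  constructor
  · rintro ⟨hx, rfl⟩
    simp [← hx]
  · rintro ⟨hy, rfl⟩
    simp [← hy]

/-- The activation flow from `x` to `y` equals the deactivation flow from `y` to `x`. -/
theorem activation_flow_eq {N C : ℕ} (E : Fin C → SimpleGraph (Fin N))
    (ν μ : Fin N → Fin C → ℝ) (hμ : ∀ i c, μ i c ≠ 0) (x y : CState N C) :
    prodWeight ν μ x * (∑ i : Fin N, ∑ c : Fin C,
      if Feasible E x ∧ Feasible E y ∧ x i = 0 ∧ y = Function.update x i c.succ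
      then ν i c else 0) =
    prodWeight ν μ y * (∑ i : Fin N, ∑ c : Fin C,
      if Feasible E y ∧ Feasible E x ∧ y i = c.succ ∧ x = Function.update y i 0
      then μ i c else 0) := by
  simp only [Finset.mul_sum]
  refine Finset.sum_congr rfl fun i _ => Finset.sum_congr rfl fun c _ => ?_
  have hiff : (Feasible E y ∧ Feasible E x ∧ y i = c.succ ∧ x = Function.update y i 0) ↔
      (Feasible E x ∧ Feasible E y ∧ x i = 0 ∧ y = Function.update x i c.succ) := by
    rw [← activation_iff_deactivation, and_left_comm]
  rw [if_congr hiff rfl rfl]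
  split_ifs with h
  · obtain ⟨-, -, hx, rfl⟩ := h
    rw [prodWeight_update ν μ hx, mul_assoc, div_mul_cancel₀ _ (hμ i c)]
  · simp

/-- The product-form distribution `π_C` satisfies the detailed balance
equations `π_C(x) q_C(x,y) = π_C(y) q_C(y,x)` for all `x, y ∈ 𝒳_C`; hence `π_C` is a
reversible (and thus stationary) distribution for the multi-channel CSMA dynamics. -/
theorem detailed_balance (N C : ℕ) (hC : 1 ≤ C) (E : Fin C → SimpleGraph (Fin N))
    (ν μ : Fin N → Fin C → ℝ) (hν : ∀ i c, 0 < ν i c) (hμ : ∀ i c, 0 < μ i c) :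
    ∀ x y : CState N C, Feasible E x → Feasible E y →
      piProd E ν μ x * qC E ν μ x y = piProd E ν μ y * qC E ν μ y x := by
  intro x y _ _
  have hμ' : ∀ i c, μ i c ≠ 0 := fun i c => (hμ i c).ne'
  have hxy := activation_flow_eq E ν μ hμ' x y
  have hyx := activation_flow_eq E ν μ hμ' y x
  simp only [piProd, div_mul_eq_mul_div]
  congr 1
  rw [qC, qC, mul_add, mul_add, hxy, hyx, add_comm]

end CSMA
end
end

section
/- Suppose the same conflict graph G = (V,E) describes the interference on all channels. Then for every C ≥ 1 the inequality C·𝒜(C+1) ≤ (C+1)·𝒜(C) holds; equivalently, the asymptotic aggregate throughput Θ(C) = 𝒜(C)/C is a non-increasing function of the number of channels C. -/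
open scoped Classical

noncomputable section

namespace CSMA

/-- `a(x)`: the number of active nodes in state `x`. -/
def activeCount {N C : ℕ} (x : CState N C) : ℕ :=
  (Finset.univ.filter fun i => x i ≠ 0).card

/-- `𝒜(C)`: the maximum number of simultaneously active nodes over feasible states. -/
def maxActive {N C : ℕ} (E : Fin C → SimpleGraph (Fin N)) : ℕ :=
  (FeasibleSet E).sup activeCount

/-- `𝒟_C`: the set of dominant states, i.e. feasible states with `𝒜(C)` active nodes. -/
def DominantSet {N C : ℕ} (E : Fin C → SimpleGraph (Fin N)) : Finset (CState N C) :=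
  (FeasibleSet E).filter fun x => activeCount x = maxActive E

/-- A single CSMA step: both states are feasible and `y` is obtained from `x` by either
the activation of a single inactive node on some channel, or the deactivation of a single
active node (a node cannot change channel in a single step). -/
def Step {N C : ℕ} (E : Fin C → SimpleGraph (Fin N)) (x y : CState N C) : Prop :=
  Feasible E x ∧ Feasible E y ∧
    ∃ i : Fin N, (∀ j : Fin N, j ≠ i → y j = x j) ∧
      ((x i = 0 ∧ y i ≠ 0) ∨ (x i ≠ 0 ∧ y i = 0))

/-- `ω` is a path of CSMA steps from `x` to `y` inside the feasible state space. -/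
def IsPath {N C : ℕ} (E : Fin C → SimpleGraph (Fin N)) (x y : CState N C)
    (ω : List (CState N C)) : Prop :=
  ω.head? = some x ∧ ω.getLast? = some y ∧ (∀ z ∈ ω, Feasible E z) ∧ ω.Chain' (Step E)

/-- The height of a path: `max_{z ∈ ω} (𝒜(C) − a(z))`. -/
def pathHeight {N C : ℕ} (E : Fin C → SimpleGraph (Fin N)) (ω : List (CState N C)) : ℕ :=
  (ω.map fun z => maxActive E - activeCount z).foldr max 0

/-- The communication height `Δ(x,y) = min_{ω : x → y} max_{z ∈ ω} (𝒜(C) − a(z))`. -/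
def commHeight {N C : ℕ} (E : Fin C → SimpleGraph (Fin N)) (x y : CState N C) : ℕ :=
  sInf {h : ℕ | ∃ ω, IsPath E x y ω ∧ pathHeight E ω = h}

/-- The communication height `Δ(x,D)` between a state and a set of states. -/
def commHeightSet {N C : ℕ} (E : Fin C → SimpleGraph (Fin N)) (x : CState N C)
    (D : Set (CState N C)) : ℕ :=
  sInf {h : ℕ | ∃ ω y, y ∈ D ∧ IsPath E x y ω ∧ pathHeight E ω = h}

/-- `Γ(C)`: the worst communication height between a pair of dominant states. -/
def Gamma {N C : ℕ} (E : Fin C → SimpleGraph (Fin N)) : ℕ :=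
  (DominantSet E).sup fun s => (DominantSet E).sup fun s' => commHeight E s s'

/-- The normalizing constant `Z(ν)` in the homogeneous case. -/
def Zhom {N C : ℕ} (E : Fin C → SimpleGraph (Fin N)) (ν : ℝ) : ℝ :=
  ∑ y ∈ FeasibleSet E, ν ^ activeCount y

/-- The homogeneous stationary distribution `π_C(x) = ν^{a(x)} / Z(ν)`. -/
def piHom {N C : ℕ} (E : Fin C → SimpleGraph (Fin N)) (ν : ℝ) (x : CState N C) : ℝ :=
  ν ^ activeCount x / Zhom E ν


/-- Switching off channel `k + 1` and relabelling the remaining channels. -/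
def dropChannel {N C : ℕ} (k : Fin (C + 1)) (x : CState N (C + 1)) : CState N C :=
  fun i => if x i = k.succ then 0 else k.predAbove (x i)

theorem eq_succAbove_of_dropChannel_eq {N C : ℕ} {k : Fin (C + 1)} {x : CState N (C + 1)}
    {i : Fin N} {c : Fin C} (h : dropChannel k x i = c.succ) :
    x i = (k.succAbove c).succ := by
  unfold dropChannel at h
  split_ifs at h with hk
  · exact absurd h.symm (Fin.succ_ne_zero c)
  · rw [← Fin.succ_succAbove_succ, ← h, Fin.succ_succAbove_predAbove hk]

theorem dropChannel_ne_zero {N C : ℕ} {k : Fin (C + 1)} {x : CState N (C + 1)} {i : Fin N}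
    (h₀ : x i ≠ 0) (hk : x i ≠ k.succ) : dropChannel k x i ≠ 0 := by
  intro h
  rw [dropChannel, if_neg hk] at h
  have := Fin.succ_succAbove_predAbove hk
  rw [h, Fin.succ_succAbove_zero] at this
  exact h₀ this.symm

theorem Feasible.dropChannel {N C : ℕ} {G : SimpleGraph (Fin N)} {x : CState N (C + 1)}
    (hx : Feasible (fun _ : Fin (C + 1) => G) x) (k : Fin (C + 1)) :
    Feasible (fun _ : Fin C => G) (dropChannel k x) :=
  fun c i j hij h => hx (k.succAbove c) i j hij
    ⟨eq_succAbove_of_dropChannel_eq h.1, eq_succAbove_of_dropChannel_eq h.2⟩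

theorem Feasible.activeCount_le_maxActive {N C : ℕ} {E : Fin C → SimpleGraph (Fin N)}
    {x : CState N C} (hx : Feasible E x) : activeCount x ≤ maxActive E :=
  Finset.le_sup (f := activeCount) (Finset.mem_filter.2 ⟨Finset.mem_univ x, hx⟩)

theorem activeCount_le_dropChannel_add {N C : ℕ} (x : CState N (C + 1)) (k : Fin (C + 1)) :
    activeCount x ≤
      activeCount (dropChannel k x) + (Finset.univ.filter fun i => x i = k.succ).card := by
  refine (Finset.card_le_card fun i hi => ?_).trans (Finset.card_union_le _ _)
  by_cases hk : x i = k.succ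
  · simp [hk]
  · simpa [hk] using dropChannel_ne_zero (Finset.mem_filter.1 hi).2 hk

theorem sum_card_channel_eq_activeCount {N C : ℕ} (x : CState N C) :
    ∑ k : Fin C, (Finset.univ.filter fun i => x i = k.succ).card = activeCount x := by
  have h := Finset.card_eq_sum_card_fiberwise (f := x) (s := Finset.univ.filter fun i => x i ≠ 0)
    (t := Finset.univ) fun _ _ => Finset.mem_coe.2 (Finset.mem_univ _)
  rw [Fin.sum_univ_succ] at h
  rw [activeCount, h, Finset.card_eq_zero.2 (by ext; simp), zero_add]
  refine Finset.sum_congr rfl fun k _ => congrArg Finset.card ?_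
  ext i
  simp only [Finset.mem_filter, Finset.mem_univ, true_and]
  exact ⟨fun hi => ⟨hi ▸ Fin.succ_ne_zero k, hi⟩, And.right⟩

theorem mul_maxActive_succ_le {N : ℕ} (G : SimpleGraph (Fin N)) (C : ℕ) :
    C * maxActive (fun _ : Fin (C + 1) => G) ≤ (C + 1) * maxActive (fun _ : Fin C => G) := by
  obtain ⟨x, hx, hmax⟩ := Finset.exists_mem_eq_sup (FeasibleSet fun _ : Fin (C + 1) => G)
    ⟨fun _ => 0, Finset.mem_filter.2
      ⟨Finset.mem_univ _, fun c _ _ _ h => Fin.succ_ne_zero c h.1.symm⟩⟩ activeCount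
  have hfeas := (Finset.mem_filter.1 hx).2
  have hsum := Finset.sum_le_sum fun (k : Fin (C + 1)) (_ : k ∈ Finset.univ) =>
    (activeCount_le_dropChannel_add x k).trans
      (Nat.add_le_add_right (hfeas.dropChannel k).activeCount_le_maxActive _)
  rw [Finset.sum_add_distrib, sum_card_channel_eq_activeCount] at hsum
  simp only [Finset.sum_const, Finset.card_univ, Fintype.card_fin, smul_eq_mul] at hsum
  rw [maxActive, hmax]
  linarith

/-- With the same conflict graph `G` on all channels, for every `C ≥ 1`
the inequality `C·𝒜(C+1) ≤ (C+1)·𝒜(C)` holds; equivalently, the asymptotic aggregate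
throughput `Θ(C) = 𝒜(C)/C` is a non-increasing function of the number of channels `C`. -/
theorem aggregate_throughput_nonincreasing (N : ℕ) (G : SimpleGraph (Fin N)) :
    ∀ C : ℕ, 1 ≤ C →
      C * maxActive (fun _ : Fin (C + 1) => G) ≤
        (C + 1) * maxActive (fun _ : Fin C => G) ∧
      (maxActive (fun _ : Fin (C + 1) => G) : ℝ) / (C + 1) ≤
        (maxActive (fun _ : Fin C => G) : ℝ) / C := by
  intro C hC
  have h := mul_maxActive_succ_le G C
  refine ⟨h, ?_⟩
  have hC' : (0 : ℝ) < C := by exact_mod_cast hC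
  rw [div_le_div_iff₀ (by positivity) hC', mul_comm, mul_comm (maxActive _ : ℝ)]
  exact_mod_cast h

end CSMA
end
end

section
/- For every pair of states x, y ∈ 𝒳_C, the minimum number of CSMA steps needed to go from x to y equals d(x,y) := #{ i ∈ V : x_i ≠ y_i } + #{ i ∈ V : x_i ≠ y_i and x_i y_i ≠ 0 }; that is, there exists a path from x to y in 𝒳_C of length d(x,y), and every path from x to y has length at least d(x,y). -/
open scoped Classical

noncomputable section

namespace CSMA

/-- `d(x,y) = #{i : x_i ≠ y_i} + #{i : x_i ≠ y_i and x_i y_i ≠ 0}`: the minimum number of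
CSMA steps needed to go from `x` to `y` (an active node must first deactivate before
activating on another channel, hence the second term). -/
def stepDist {N C : ℕ} (x y : CState N C) : ℕ :=
  (Finset.univ.filter fun i => x i ≠ y i).card +
    (Finset.univ.filter fun i => x i ≠ y i ∧ x i ≠ 0 ∧ y i ≠ 0).card

/-- The number of CSMA steps a single node needs to change its activity from `a` to `b`. -/
def nodeDist {C : ℕ} (a b : Fin (C + 1)) : ℕ :=
  (if a ≠ b then 1 else 0) + if a ≠ b ∧ a ≠ 0 ∧ b ≠ 0 then 1 else 0

lemma nodeDist_zero_left {C : ℕ} {b : Fin (C + 1)} (hb : b ≠ 0) : nodeDist 0 b = 1 := by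
  simp [nodeDist, hb.symm]

lemma nodeDist_self {C : ℕ} (a : Fin (C + 1)) : nodeDist a a = 0 := by
  simp [nodeDist]

lemma nodeDist_eq_nodeDist_zero_add_one {C : ℕ} {a b : Fin (C + 1)} (hab : a ≠ b)
    (ha : a ≠ 0) : nodeDist a b = nodeDist 0 b + 1 := by
  by_cases hb : b = 0
  · subst hb
    simp [nodeDist, ha]
  · simp [nodeDist, hab, ha, hb, Ne.symm hb]

lemma nodeDist_le_nodeDist_zero_add_one {C : ℕ} (a b : Fin (C + 1)) :
    nodeDist a b ≤ nodeDist 0 b + 1 := by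
  by_cases hab : a = b
  · simp [hab, nodeDist_self]
  · by_cases ha : a = 0
    · simp [ha]
    · exact (nodeDist_eq_nodeDist_zero_add_one hab ha).le

lemma nodeDist_zero_le_nodeDist_add_one {C : ℕ} (a b : Fin (C + 1)) :
    nodeDist 0 b ≤ nodeDist a b + 1 := by
  by_cases hb : b = 0
  · simp [hb, nodeDist_self]
  · simp [nodeDist_zero_left hb]

lemma stepDist_eq_sum_nodeDist {N C : ℕ} (x y : CState N C) :
    stepDist x y = ∑ i, nodeDist (x i) (y i) := by
  simp only [stepDist, nodeDist, Finset.card_filter, Finset.sum_add_distrib]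

lemma stepDist_self {N C : ℕ} (x : CState N C) : stepDist x x = 0 := by
  simp [stepDist]

lemma stepDist_add_nodeDist {N C : ℕ} {x z : CState N C} (y : CState N C) {i : Fin N}
    (h : ∀ j, j ≠ i → z j = x j) :
    stepDist x y + nodeDist (z i) (y i) = stepDist z y + nodeDist (x i) (y i) := by
  rw [stepDist_eq_sum_nodeDist, stepDist_eq_sum_nodeDist,
    ← Finset.add_sum_erase _ _ (Finset.mem_univ i),
    ← Finset.add_sum_erase _ (fun j => nodeDist (z j) (y j)) (Finset.mem_univ i)]
  have hsum : ∑ j ∈ Finset.univ.erase i, nodeDist (z j) (y j) =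
      ∑ j ∈ Finset.univ.erase i, nodeDist (x j) (y j) :=
    Finset.sum_congr rfl fun j hj => by rw [h j (Finset.ne_of_mem_erase hj)]
  rw [hsum]
  ring

lemma Step.stepDist_le {N C : ℕ} {E : Fin C → SimpleGraph (Fin N)} {x z : CState N C}
    (h : Step E x z) (y : CState N C) : stepDist x y ≤ stepDist z y + 1 := by
  obtain ⟨-, -, i, hi, ⟨hx, -⟩ | ⟨-, hz⟩⟩ := h
  · have h1 := stepDist_add_nodeDist y hi
    have h2 := nodeDist_zero_le_nodeDist_add_one (z i) (y i)
    rw [hx] at h1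
    omega
  · have h1 := stepDist_add_nodeDist y hi
    have h2 := nodeDist_le_nodeDist_zero_add_one (x i) (y i)
    rw [hz] at h1
    omega

/-- Deactivating nodes preserves feasibility. -/
lemma Feasible.of_eq_zero_or_eq {N C : ℕ} {E : Fin C → SimpleGraph (Fin N)}
    {x z : CState N C} (hx : Feasible E x) (h : ∀ j, z j = 0 ∨ z j = x j) :
    Feasible E z := by
  have key : ∀ (c : Fin C) (j : Fin N), z j = c.succ → x j = c.succ := by
    intro c j hj
    rcases h j with h0 | h1
    · exact absurd (hj.symm.trans h0) (Fin.succ_ne_zero c)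
    · exact h1.symm.trans hj
  exact fun c i j hij hz => hx c i j hij ⟨key c i hz.1, key c j hz.2⟩

lemma exists_step_stepDist_eq {N C : ℕ} {E : Fin C → SimpleGraph (Fin N)}
    {x y : CState N C} (hx : Feasible E x) (hy : Feasible E y) (hxy : x ≠ y) :
    ∃ z, Step E x z ∧ stepDist x y = stepDist z y + 1 := by
  by_cases hact : ∃ i, x i ≠ y i ∧ x i ≠ 0
  · obtain ⟨i, hi, hi0⟩ := hact
    have hne : ∀ j, j ≠ i → Function.update x i 0 j = x j :=
      fun j hj => Function.update_of_ne hj _ _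
    have hfeas : Feasible E (Function.update x i 0) := by
      refine hx.of_eq_zero_or_eq fun j => ?_
      by_cases hj : j = i
      · subst hj
        simp
      · exact Or.inr (hne j hj)
    refine ⟨_, ⟨hx, hfeas, i, hne, Or.inr ⟨hi0, Function.update_self ..⟩⟩, ?_⟩
    have h1 := stepDist_add_nodeDist y hne
    have h2 := nodeDist_eq_nodeDist_zero_add_one hi hi0
    rw [Function.update_self] at h1
    omega
  · push Not at hact
    obtain ⟨i, hi⟩ := Function.ne_iff.mp hxy
    have hi0 : x i = 0 := hact i hi
    have hyi : y i ≠ 0 := fun h => hi (hi0.trans h.symm)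
    have hne : ∀ j, j ≠ i → Function.update x i (y i) j = x j :=
      fun j hj => Function.update_of_ne hj _ _
    have hfeas : Feasible E (Function.update x i (y i)) := by
      refine hy.of_eq_zero_or_eq fun j => ?_
      by_cases hj : j = i
      · subst hj
        simp
      · rw [hne j hj]
        by_cases hxj : x j = y j
        · exact Or.inr hxj
        · exact Or.inl (hact j hxj)
    refine ⟨_, ⟨hx, hfeas, i, hne, Or.inl ⟨hi0, ?_⟩⟩, ?_⟩
    · rwa [Function.update_self]
    · have h1 := stepDist_add_nodeDist y hne
      rw [Function.update_self, hi0, nodeDist_zero_left hyi, nodeDist_self] at h1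
      omega

lemma IsPath.cons {N C : ℕ} {E : Fin C → SimpleGraph (Fin N)} {x y z : CState N C}
    {ω : List (CState N C)} (hxz : Step E x z) (h : IsPath E z y ω) :
    IsPath E x y (x :: ω) := by
  obtain ⟨hhead, hlast, hfeas, hchain⟩ := h
  refine ⟨rfl, ?_, ?_, ?_⟩
  · simp [List.getLast?_cons, hlast]
  · simpa using ⟨hxz.1, hfeas⟩
  · refine List.isChain_cons.mpr ⟨fun w hw => ?_, hchain⟩
    rw [hhead] at hw
    cases hw
    exact hxz

lemma exists_isPath_length_eq {N C : ℕ} {E : Fin C → SimpleGraph (Fin N)}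
    {x y : CState N C} (hx : Feasible E x) (hy : Feasible E y) :
    ∃ ω, IsPath E x y ω ∧ ω.length = stepDist x y + 1 := by
  induction hn : stepDist x y generalizing x with
  | zero =>
    have hxy : x = y := by
      by_contra hne
      obtain ⟨z, -, hz⟩ := exists_step_stepDist_eq hx hy hne
      omega
    subst hxy
    exact ⟨[x], ⟨rfl, rfl, by simpa using hx, List.isChain_singleton x⟩, rfl⟩
  | succ n ih =>
    have hne : x ≠ y := by
      rintro rfl
      simp [stepDist_self] at hn
    obtain ⟨z, hstep, hz⟩ := exists_step_stepDist_eq hx hy hne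
    obtain ⟨ω, hω, hlen⟩ := ih hstep.2.1 (by omega)
    exact ⟨x :: ω, hω.cons hstep, by simp [hlen]⟩

lemma IsPath.stepDist_lt_length {N C : ℕ} {E : Fin C → SimpleGraph (Fin N)}
    {x y : CState N C} {ω : List (CState N C)} (h : IsPath E x y ω) :
    stepDist x y < ω.length := by
  induction ω generalizing x with
  | nil => simp [IsPath] at h
  | cons a l ih =>
    obtain ⟨hhead, hlast, hfeas, hchain⟩ := h
    obtain rfl : a = x := by simpa using hhead
    cases l with
    | nil =>
      obtain rfl : a = y := by simpa using hlast
      simp [stepDist_self]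
    | cons b l =>
      obtain ⟨hab, hchain⟩ := List.isChain_cons_cons.mp hchain
      have hb : stepDist b y < (b :: l).length :=
        ih ⟨rfl, by simpa using hlast, fun w hw => hfeas w (List.mem_cons_of_mem _ hw), hchain⟩
      have := hab.stepDist_le y
      simp only [List.length_cons] at hb ⊢
      omega

/-- For every pair of states `x, y ∈ 𝒳_C`, the minimum number of CSMA
steps needed to go from `x` to `y` equals `d(x,y)`: there is a path from `x` to `y` in
`𝒳_C` with exactly `d(x,y)` steps (i.e. `d(x,y) + 1` states), and every path from `x` to
`y` has at least `d(x,y)` steps. -/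
theorem stepDist_eq_min_path_length (N C : ℕ) (hC : 1 ≤ C)
    (E : Fin C → SimpleGraph (Fin N)) (x y : CState N C)
    (hx : Feasible E x) (hy : Feasible E y) :
    (∃ ω, IsPath E x y ω ∧ ω.length = stepDist x y + 1) ∧
    ∀ ω, IsPath E x y ω → stepDist x y + 1 ≤ ω.length := by
  exact ⟨exists_isPath_length_eq hx hy, fun _ h => h.stepDist_lt_length⟩

end CSMA
end
end
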